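/- Let φ be a spherically symmetric wave on D whose horizon limits φ_H and φ_H' exist, and fix −1 < q < 1 with F_q[φ] := ∫_{−∞}^{u₀} |∂_u φ|(u',v₀) du' + ∫_{v₀}^{∞} v'^{−q}·|φ_H'(v')| dv' < ∞. Then there exists a constant C = C(M, u₀, v₀, q) > 0, independent of φ, such that for all (u,v) ∈ D the outgoing derivative ∂_V φ(u,v) := Ω^{−2}(u₀,v)·∂_v φ(u,v) satisfies |∂_V φ(u,v)| ≤ C·( v²·|φ_H'(v)| + F_q[φ] ). -/

import Mathlib

open Filter MeasureTheory Set Topology intervalIntegral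

noncomputable section

/-- The extremal Reissner--Nordström tortoise function. -/
def rstar (M ρ : ℝ) : ℝ := M ^ 2 / (M - ρ) + 2 * M * Real.log (M - ρ) + ρ

/-- The data of a spherically symmetric wave on the interior region
`D = (-∞, u₀] × [v₀, ∞)` of extremal Reissner--Nordström: the radius function `r`,
the wave `φ` together with its partial derivatives, and the wave equation. -/
structure WaveSetup (M u₀ v₀ : ℝ) where
  hM : 0 < M
  hu₀ : u₀ < 0
  hv₀ : 0 < v₀
  hdom : M + 2 * M * Real.log M < v₀ - u₀
  /-- the area radius function, defined implicitly by `rstar M (r u v) = v - u` -/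
  r : ℝ → ℝ → ℝ
  hr_mem : ∀ u v : ℝ, M + 2 * M * Real.log M < v - u → r u v ∈ Set.Ioo 0 M
  hr_star : ∀ u v : ℝ, M + 2 * M * Real.log M < v - u → rstar M (r u v) = v - u
  /-- the wave -/
  φ : ℝ → ℝ → ℝ
  /-- `∂_u φ` -/
  φu : ℝ → ℝ → ℝ
  /-- `∂_v φ` -/
  φv : ℝ → ℝ → ℝ
  /-- `∂_v ∂_u φ` -/
  φuv : ℝ → ℝ → ℝ
  /-- `∂_v ∂_v φ` -/
  φvv : ℝ → ℝ → ℝ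
  hφu : ∀ u ∈ Set.Iic u₀, ∀ v ∈ Set.Ici v₀,
    HasDerivWithinAt (fun u' => φ u' v) (φu u v) (Set.Iic u₀) u
  hφv : ∀ u ∈ Set.Iic u₀, ∀ v ∈ Set.Ici v₀,
    HasDerivWithinAt (fun v' => φ u v') (φv u v) (Set.Ici v₀) v
  hφuv : ∀ u ∈ Set.Iic u₀, ∀ v ∈ Set.Ici v₀,
    HasDerivWithinAt (fun v' => φu u v') (φuv u v) (Set.Ici v₀) v
  hφvv : ∀ u ∈ Set.Iic u₀, ∀ v ∈ Set.Ici v₀,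
    HasDerivWithinAt (fun v' => φv u v') (φvv u v) (Set.Ici v₀) v
  hφ_cont : ContinuousOn (fun p : ℝ × ℝ => φ p.1 p.2) (Set.Iic u₀ ×ˢ Set.Ici v₀)
  hφu_cont : ContinuousOn (fun p : ℝ × ℝ => φu p.1 p.2) (Set.Iic u₀ ×ˢ Set.Ici v₀)
  hφv_cont : ContinuousOn (fun p : ℝ × ℝ => φv p.1 p.2) (Set.Iic u₀ ×ˢ Set.Ici v₀)
  /-- the wave equation `r ∂_u∂_v φ + (∂_u r) ∂_v φ + (∂_v r) ∂_u φ = 0`,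
  with `∂_u r = -Ω²` and `∂_v r = Ω²`, `Ω² = (1 - M/r)²`. -/
  hwave : ∀ u ∈ Set.Iic u₀, ∀ v ∈ Set.Ici v₀,
    r u v * φuv u v - (1 - M / r u v) ^ 2 * φv u v + (1 - M / r u v) ^ 2 * φu u v = 0

namespace WaveSetup

variable {M u₀ v₀ : ℝ}

/-- The conformal factor `Ω²(u,v) = (1 - M/r(u,v))²`. -/
def Ω2 (W : WaveSetup M u₀ v₀) (u v : ℝ) : ℝ := (1 - M / W.r u v) ^ 2

/-- The regular outgoing derivative `∂_V φ = Ω⁻²(u₀,v) ∂_v φ`. -/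
def dVφ (W : WaveSetup M u₀ v₀) (u v : ℝ) : ℝ := (W.Ω2 u₀ v)⁻¹ * W.φv u v

/-- The regular outgoing derivative of `r φ`:
`∂_V (r φ) = Ω⁻²(u₀,v) (∂_v r · φ + r ∂_v φ)` with `∂_v r = Ω²(u,v)`. -/
def dVrφ (W : WaveSetup M u₀ v₀) (u v : ℝ) : ℝ :=
  (W.Ω2 u₀ v)⁻¹ * (W.Ω2 u v * W.φ u v + W.r u v * W.φv u v)

/-- The second regular outgoing derivative `∂_V² φ = Ω⁻²(u₀,v) ∂_v (∂_V φ)`,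
computed using `∂_v Ω²(u₀,v) = 2 (1 - M/r)(M/r²) Ω²(u₀,v)`. -/
def dV2φ (W : WaveSetup M u₀ v₀) (u v : ℝ) : ℝ :=
  ((W.Ω2 u₀ v)⁻¹) ^ 2 * W.φvv u v
    - 2 * (1 - M / W.r u₀ v) * (M / (W.r u₀ v) ^ 2) * ((W.Ω2 u₀ v)⁻¹) ^ 2 * W.φv u v

/-- `∂_u (r φ) = (∂_u r) φ + r ∂_u φ = -Ω² φ + r ∂_u φ`. -/
def duRφ (W : WaveSetup M u₀ v₀) (u v : ℝ) : ℝ :=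
  -W.Ω2 u v * W.φ u v + W.r u v * W.φu u v

end WaveSetup

/-- A spherically symmetric wave whose horizon limits exist:
`φ_H(v) = lim_{u → -∞} φ(u,v)` and `φ_H'(v) = lim_{u → -∞} ∂_v φ(u,v)` exist
locally uniformly in `v`, with `φ_H` differentiable and `(φ_H)' = φ_H'`. -/
structure WaveSetupH (M u₀ v₀ : ℝ) extends WaveSetup M u₀ v₀ where
  φH : ℝ → ℝ
  φH' : ℝ → ℝ
  hφH_tendsto : TendstoLocallyUniformlyOn (fun u v => φ u v) φH Filter.atBot (Set.Ici v₀)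
  hφH'_tendsto : TendstoLocallyUniformlyOn (fun u v => φv u v) φH' Filter.atBot (Set.Ici v₀)
  hφH_deriv : ∀ v ∈ Set.Ici v₀, HasDerivWithinAt φH (φH' v) (Set.Ici v₀) v

end

theorem rstar_zero {M : ℝ} (hM : 0 < M) : rstar M 0 = M + 2 * M * Real.log M := by
  simp only [rstar, sub_zero, add_zero]
  field_simp

theorem hasStrictDerivAt_rstar {M ρ : ℝ} (hρ : ρ < M) :
    HasStrictDerivAt (rstar M) (ρ ^ 2 / (M - ρ) ^ 2) ρ := by
  have hx : M - ρ ≠ 0 := (sub_pos.2 hρ).ne'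
  have h1 : HasStrictDerivAt (fun t : ℝ => M - t) (-1) ρ := (hasStrictDerivAt_id ρ).const_sub M
  have h2 := (((hasStrictDerivAt_inv hx).comp ρ h1).const_mul (M ^ 2)).add
    ((h1.log hx).const_mul (2 * M))
  have h3 := h2.add (hasStrictDerivAt_id ρ)
  convert! h3 using 1
  field_simp
  ring

theorem rstar_strictMonoOn {M : ℝ} : StrictMonoOn (rstar M) (Ioo 0 M) := by
  refine strictMonoOn_of_deriv_pos (convex_Ioo 0 M)
    (fun x hx => (hasStrictDerivAt_rstar hx.2).hasDerivAt.continuousAt.continuousWithinAt) ?_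
  intro x hx
  rw [interior_Ioo] at hx
  rw [(hasStrictDerivAt_rstar hx.2).hasDerivAt.deriv]
  have h1 := hx.1
  have h2 := sub_pos.2 hx.2
  positivity

theorem rstar_mul_sub_le {M ρ : ℝ} (hρ : ρ ∈ Ioo 0 M) :
    rstar M ρ * (M - ρ) ≤ 2 * M ^ 2 + 2 * M ^ 3 := by
  have hρ0 := hρ.1
  have hx : 0 < M - ρ := sub_pos.2 hρ.2
  have hM : 0 < M := hρ0.trans hρ.2
  have hlog : Real.log (M - ρ) ≤ M := (Real.log_le_self hx.le).trans (by linarith)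
  have h1 : Real.log (M - ρ) * (M - ρ) ≤ M * M := by
    calc Real.log (M - ρ) * (M - ρ) ≤ M * (M - ρ) := by gcongr
      _ ≤ M * M := by gcongr; linarith
  have h2 : ρ * (M - ρ) ≤ M * M := by nlinarith
  have h3 : rstar M ρ * (M - ρ) =
      M ^ 2 + 2 * M * (Real.log (M - ρ) * (M - ρ)) + ρ * (M - ρ) := by
    rw [rstar]; field_simp
  rw [h3]
  nlinarith [mul_le_mul_of_nonneg_left h1 hM.le]

theorem exists_inv_sub_le_rstar {M : ℝ} (hM : 0 < M) :
    ∃ L : ℝ, 0 ≤ L ∧ ∀ ρ ∈ Ioo 0 M, M ^ 2 / (2 * (M - ρ)) ≤ rstar M ρ + L := by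
  refine ⟨|2 * M * Real.log (M / 4)|, abs_nonneg _, fun ρ hρ => ?_⟩
  have hρ0 := hρ.1
  have hx : 0 < M - ρ := sub_pos.2 hρ.2
  have h1 := Real.log_le_sub_one_of_pos (show 0 < M / 4 / (M - ρ) by positivity)
  rw [Real.log_div (by positivity) hx.ne'] at h1
  have h2 := mul_le_mul_of_nonneg_left h1 (show 0 ≤ 2 * M by positivity)
  have h3 : 2 * M * (M / 4 / (M - ρ) - 1) = M ^ 2 / (2 * (M - ρ)) - 2 * M := by
    field_simp
    ring
  have h4 : M ^ 2 / (M - ρ) = M ^ 2 / (2 * (M - ρ)) + M ^ 2 / (2 * (M - ρ)) := by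
    field_simp
    ring
  rw [rstar, h4]
  nlinarith [neg_abs_le (2 * M * Real.log (M / 4))]

theorem exists_le_of_lt_rstar {M s₀ : ℝ} (hM : 0 < M) (hs₀ : M + 2 * M * Real.log M < s₀) :
    ∃ δ > 0, ∀ ρ ∈ Ioo 0 M, s₀ ≤ rstar M ρ → δ ≤ ρ := by
  have hc := (hasStrictDerivAt_rstar hM).hasDerivAt.continuousAt
  rw [← rstar_zero hM] at hs₀
  obtain ⟨δ, hδ, h⟩ := Metric.eventually_nhds_iff.1 (hc.eventually_lt_const hs₀)
  refine ⟨δ, hδ, fun ρ hρ hs => ?_⟩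
  by_contra! hlt
  refine (h (y := ρ) ?_).not_ge hs
  rwa [Real.dist_eq, sub_zero, abs_of_pos hρ.1]

/-- A right inverse of the tortoise function with values in `(0, M)` is differentiable. -/
theorem hasDerivAt_of_rstar_eq {M c : ℝ} {R : ℝ → ℝ} (hR : ∀ s, c < s → R s ∈ Ioo 0 M)
    (hRs : ∀ s, c < s → rstar M (R s) = s) {s : ℝ} (hs : c < s) :
    HasDerivAt R ((1 - M / R s) ^ 2) s := by
  have hm := hR s hs
  have hne : (R s) ^ 2 / (M - R s) ^ 2 ≠ 0 := by
    have h1 := hm.1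
    have h2 := sub_pos.2 hm.2
    positivity
  have hd := hasStrictDerivAt_rstar hm.2
  have hleft : ∀ᶠ x in 𝓝 (R s), R (rstar M x) = x := by
    have h1 : ∀ᶠ x in 𝓝 (R s), c < rstar M x := by
      refine hd.hasDerivAt.continuousAt.eventually_const_lt ?_
      rwa [hRs s hs]
    filter_upwards [h1, isOpen_Ioo.mem_nhds hm] with x hx hxm
    exact rstar_strictMonoOn.injOn (hR _ hx) hxm (hRs _ hx)
  have h := (hd.to_local_left_inverse hne hleft).hasDerivAt
  rw [hRs s hs] at h
  convert! h using 1
  have h1 := hm.1.ne'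
  rw [inv_div, ← div_pow, sub_div, div_self h1, ← neg_sq, neg_sub]

/-- If `c` is the mixed derivative `∂_v ∂_u f`, then it is also `∂_u ∂_v f`, in integrated form. -/
theorem sub_eq_integral_of_mixed {u₀ v₀ : ℝ} {f a b c : ℝ → ℝ → ℝ}
    (ha : Continuous fun p : ℝ × ℝ => a p.1 p.2) (hc : Continuous fun p : ℝ × ℝ => c p.1 p.2)
    (hfa : ∀ u ≤ u₀, ∀ v, v₀ ≤ v → HasDerivWithinAt (fun u' => f u' v) (a u v) (Iic u₀) u)
    (hfb : ∀ u ≤ u₀, ∀ v, v₀ ≤ v → HasDerivWithinAt (fun v' => f u v') (b u v) (Ici v₀) v)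
    (hac : ∀ u ≤ u₀, ∀ v, v₀ ≤ v → HasDerivWithinAt (fun v' => a u v') (c u v) (Ici v₀) v)
    {U u v : ℝ} (hU : U ≤ u) (hu : u ≤ u₀) (hv : v₀ ≤ v) :
    b u v - b U v = ∫ w in U..u, c w v := by
  have hc1 : Continuous fun p : ℝ × ℝ => c p.2 p.1 := hc.comp continuous_swap
  have hFu : ∀ z, v₀ ≤ z → f u z - f U z = ∫ w in U..u, a w z := by
    intro z hz
    rw [integral_eq_sub_of_hasDeriv_right_of_le hU (f := fun w => f w z) (f' := fun w => a w z)]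
    · exact fun w hw => ((hfa w (hw.2.trans hu) z hz).mono
        (fun t ht => ht.2.trans hu)).continuousWithinAt
    · intro w hw
      exact ((hfa w (hw.2.le.trans hu) z hz).hasDerivAt
        (Iic_mem_nhds (hw.2.trans_le hu))).hasDerivWithinAt
    · exact (ha.comp (Continuous.prodMk_left z)).intervalIntegrable _ _
  have hac' : ∀ w ≤ u₀, ∀ z, v₀ ≤ z → a w z = a w v₀ + ∫ t in v₀..z, c w t := by
    intro w hw z hz
    rw [integral_eq_sub_of_hasDeriv_right_of_le hz (f := fun t => a w t) (f' := fun t => c w t)]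
    · ring
    · exact (ha.comp (Continuous.prodMk_right w)).continuousOn
    · intro t ht
      exact ((hac w hw t ht.1.le).hasDerivAt (Ici_mem_nhds ht.1)).hasDerivWithinAt
    · exact (hc.comp (Continuous.prodMk_right w)).intervalIntegrable _ _
  have hH : Continuous fun t => ∫ w in U..u, c w t :=
    intervalIntegral.continuous_parametric_intervalIntegral_of_continuous' hc1 U u
  have hF : ∀ z, v₀ ≤ z → f u z - f U z =
      (∫ w in U..u, a w v₀) + ∫ t in v₀..z, ∫ w in U..u, c w t := by
    intro z hz
    rw [hFu z hz, ← intervalIntegral_intervalIntegral_swap,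
      ← intervalIntegral.integral_add]
    · refine intervalIntegral.integral_congr fun w hw => ?_
      rw [uIcc_of_le hU] at hw
      exact hac' w (hw.2.trans hu) z hz
    · exact (ha.comp (Continuous.prodMk_left v₀)).intervalIntegrable _ _
    · exact (intervalIntegral.continuous_parametric_intervalIntegral_of_continuous' hc
        v₀ z).intervalIntegrable _ _
    · exact (hc.continuousOn.integrableOn_compact
        (isCompact_uIcc.prod isCompact_uIcc)).mono_set
        (prod_mono uIoc_subset_uIcc uIoc_subset_uIcc)
  have h1 : HasDerivWithinAt (fun z => f u z - f U z) (b u v - b U v) (Ici v₀) v :=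
    (hfb u hu v hv).sub (hfb U (hU.trans hu) v hv)
  have h2 : HasDerivWithinAt (fun z => f u z - f U z) (∫ w in U..u, c w v) (Ici v₀) v := by
    refine HasDerivWithinAt.congr (f := fun z => (∫ w in U..u, a w v₀) +
      ∫ t in v₀..z, ∫ w in U..u, c w t) ?_ (fun z hz => hF z hz) (hF v hv)
    exact ((hH.integral_hasStrictDerivAt v₀ v).hasDerivAt.const_add _).hasDerivWithinAt
  exact (uniqueDiffOn_Ici v₀ v hv).eq_deriv _ h1 h2

theorem integral_div_sub_sq_le {K U u₀ z : ℝ} (hK : 0 ≤ K) (hU : U ≤ u₀) (hz : u₀ < z) :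
    ∫ w in U..u₀, K / (z - w) ^ 2 ≤ K / (z - u₀) := by
  have hpos : ∀ w ∈ uIcc U u₀, z - w ≠ 0 := by
    intro w hw
    rw [uIcc_of_le hU] at hw
    exact (sub_pos.2 (hw.2.trans_lt hz)).ne'
  rw [integral_eq_sub_of_hasDerivAt (f := fun w => K / (z - w))]
  · have : 0 ≤ K / (z - U) := div_nonneg hK (by linarith)
    linarith
  · intro w hw
    have h := (hasDerivAt_const w K).fun_div ((hasDerivAt_id w).const_sub z) (hpos w hw)
    convert! h using 1
    simp
  · refine ContinuousOn.intervalIntegrable ?_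
    exact continuousOn_const.div (by fun_prop) (fun w hw => pow_ne_zero 2 (hpos w hw))

section Characteristic

variable {u₀ v₀ K U : ℝ} {X Y k : ℝ → ℝ → ℝ}

/-- The transport equation along ingoing rays bounds `X` by its initial value and the `L¹` norm of
`Y` along the ray. -/
theorem abs_le_of_transport (hs : u₀ < v₀) (hK : 0 ≤ K)
    (hYc : Continuous fun p : ℝ × ℝ => Y p.1 p.2)
    (hkc : Continuous fun p : ℝ × ℝ => k p.1 p.2)
    (hk0 : ∀ u ≤ u₀, ∀ v, v₀ ≤ v → 0 ≤ k u v)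
    (hkK : ∀ u ≤ u₀, ∀ v, v₀ ≤ v → k u v ≤ K / (v - u) ^ 2)
    (hX : ∀ u ∈ Icc U u₀, ∀ v, v₀ ≤ v → X u v - X U v = -∫ w in U..u, k w v * Y w v)
    {u v : ℝ} (hu : u ∈ Icc U u₀) (hv : v₀ ≤ v) :
    |X u v| ≤ |X U v| + K / (v - u₀) ^ 2 * ∫ w in U..u₀, |Y w v| := by
  have hYv : Continuous fun w => Y w v := hYc.comp (Continuous.prodMk_left v)
  have hkv : Continuous fun w => k w v := hkc.comp (Continuous.prodMk_left v)
  have h1 : |∫ w in U..u, k w v * Y w v| ≤ ∫ w in U..u, K / (v - u₀) ^ 2 * |Y w v| := by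
    refine (abs_integral_le_integral_abs hu.1).trans (integral_mono_on hu.1 ?_ ?_ ?_)
    · exact (hkv.mul hYv).abs.intervalIntegrable _ _
    · exact (hYv.abs.const_mul _).intervalIntegrable _ _
    · intro w hw
      have hwu : w ≤ u₀ := hw.2.trans hu.2
      rw [abs_mul, abs_of_nonneg (hk0 w hwu v hv)]
      refine mul_le_mul_of_nonneg_right ((hkK w hwu v hv).trans ?_) (abs_nonneg _)
      have : 0 < v - u₀ := by linarith
      gcongr
  have h2 : ∫ w in U..u, |Y w v| ≤ ∫ w in U..u₀, |Y w v| :=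
    integral_mono_interval le_rfl hu.1 hu.2 (ae_of_all _ fun w => abs_nonneg _)
      (hYv.abs.intervalIntegrable _ _)
  have h3 : X u v = X U v + -∫ w in U..u, k w v * Y w v := by
    rw [← hX u hu v hv]; ring
  rw [h3]
  refine (abs_add_le _ _).trans (add_le_add_right ?_ _)
  rw [abs_neg]
  refine h1.trans ?_
  rw [intervalIntegral.integral_const_mul]
  gcongr

/-- The `L¹` norm of `Y` along ingoing rays grows at most by the weighted integral of a pointwise
bound `h` for `X`. -/
theorem integral_abs_le_of_transport (hs : u₀ < v₀) (hK : 0 ≤ K) (hU : U ≤ u₀)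
    (hXc : Continuous fun p : ℝ × ℝ => X p.1 p.2) (hYc : Continuous fun p : ℝ × ℝ => Y p.1 p.2)
    (hkc : Continuous fun p : ℝ × ℝ => k p.1 p.2)
    (hk0 : ∀ u ≤ u₀, ∀ v, v₀ ≤ v → 0 ≤ k u v)
    (hkK : ∀ u ≤ u₀, ∀ v, v₀ ≤ v → k u v ≤ K / (v - u) ^ 2)
    (hY : ∀ u ∈ Icc U u₀, ∀ v, v₀ ≤ v → Y u v - Y u v₀ = ∫ z in v₀..v, k u z * X u z)
    {h : ℝ → ℝ} (hc : Continuous h)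
    (hXh : ∀ u ∈ Icc U u₀, ∀ v, v₀ ≤ v → |X u v| ≤ h v) {v : ℝ} (hv : v₀ ≤ v) :
    ∫ w in U..u₀, |Y w v| ≤
      (∫ w in U..u₀, |Y w v₀|) + ∫ z in v₀..v, K / (max z v₀ - u₀) * h z := by
  have hD : ∀ p : ℝ × ℝ, 0 < max p.2 v₀ - min p.1 u₀ := fun p =>
    sub_pos.2 ((min_le_right _ _).trans_lt (hs.trans_le (le_max_right _ _)))
  have hGc : Continuous fun p : ℝ × ℝ => K / (max p.2 v₀ - min p.1 u₀) ^ 2 * h p.2 :=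
    (continuous_const.div (by fun_prop) (fun p => pow_ne_zero 2 (hD p).ne')).mul
      (hc.comp continuous_snd)
  have hGcs : Continuous fun p : ℝ × ℝ => K / (max p.1 v₀ - min p.2 u₀) ^ 2 * h p.1 :=
    hGc.comp continuous_swap
  have hh0 : ∀ z, v₀ ≤ z → 0 ≤ h z := fun z hz =>
    (abs_nonneg _).trans (hXh U ⟨le_rfl, hU⟩ z hz)
  have hpt : ∀ w ∈ Icc U u₀, |Y w v| ≤ |Y w v₀| +
      ∫ z in v₀..v, K / (max z v₀ - min w u₀) ^ 2 * h z := by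
    intro w hw
    have h3 : Y w v = Y w v₀ + ∫ z in v₀..v, k w z * X w z := by
      rw [← hY w hw v hv]; ring
    rw [h3]
    refine (abs_add_le _ _).trans (add_le_add_right ?_ _)
    refine (abs_integral_le_integral_abs hv).trans (integral_mono_on hv ?_ ?_ ?_)
    · exact ((hkc.mul hXc).comp (Continuous.prodMk_right w)).abs.intervalIntegrable _ _
    · exact (hGc.comp (Continuous.prodMk_right w)).intervalIntegrable _ _
    · intro z hz
      rw [abs_mul, abs_of_nonneg (hk0 w hw.2 z hz.1), max_eq_left hz.1, min_eq_left hw.2]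
      exact mul_le_mul (hkK w hw.2 z hz.1) (hXh w hw z hz.1) (abs_nonneg _) (by positivity)
  have hYc' : ∀ z, Continuous fun w => |Y w z| := fun z =>
    (hYc.comp (Continuous.prodMk_left z)).abs
  have hIc : Continuous fun w => ∫ z in v₀..v, K / (max z v₀ - min w u₀) ^ 2 * h z :=
    continuous_parametric_intervalIntegral_of_continuous'
      (f := fun w z => K / (max z v₀ - min w u₀) ^ 2 * h z) hGc v₀ v
  have hJc : Continuous fun z => ∫ w in U..u₀, K / (max z v₀ - min w u₀) ^ 2 * h z :=
    continuous_parametric_intervalIntegral_of_continuous'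
      (f := fun z w => K / (max z v₀ - min w u₀) ^ 2 * h z) hGcs U u₀
  have hdc : Continuous fun z => K / (max z v₀ - u₀) * h z :=
    (continuous_const.div (by fun_prop)
      (fun z => (sub_pos.2 (hs.trans_le (le_max_right _ _))).ne')).mul hc
  calc ∫ w in U..u₀, |Y w v|
      ≤ ∫ w in U..u₀, (|Y w v₀| + ∫ z in v₀..v, K / (max z v₀ - min w u₀) ^ 2 * h z) :=
        integral_mono_on hU ((hYc' v).intervalIntegrable _ _)
          (((hYc' v₀).add hIc).intervalIntegrable _ _) hpt
    _ = (∫ w in U..u₀, |Y w v₀|) +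
        ∫ w in U..u₀, ∫ z in v₀..v, K / (max z v₀ - min w u₀) ^ 2 * h z :=
        intervalIntegral.integral_add ((hYc' v₀).intervalIntegrable _ _)
          (hIc.intervalIntegrable _ _)
    _ = (∫ w in U..u₀, |Y w v₀|) +
        ∫ z in v₀..v, ∫ w in U..u₀, K / (max z v₀ - min w u₀) ^ 2 * h z := by
        rw [intervalIntegral_intervalIntegral_swap
          (F := fun w z => K / (max z v₀ - min w u₀) ^ 2 * h z)]
        exact (hGc.continuousOn.integrableOn_compact
          (isCompact_uIcc.prod isCompact_uIcc)).mono_set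
          (prod_mono uIoc_subset_uIcc uIoc_subset_uIcc)
    _ ≤ _ := by
        refine add_le_add_right (integral_mono_on hv (hJc.intervalIntegrable _ _)
          (hdc.intervalIntegrable _ _) ?_) _
        intro z hz
        rw [intervalIntegral.integral_mul_const, max_eq_left hz.1]
        refine mul_le_mul_of_nonneg_right ?_ (hh0 z hz.1)
        refine le_of_eq_of_le (integral_congr fun w hw => ?_)
          (integral_div_sub_sq_le hK hU (hs.trans_le hz.1))
        rw [uIcc_of_le hU] at hw
        simp only [min_eq_left hw.2]

/-- Grönwall estimate for a characteristic system with kernel decaying quadratically in `v - u`. -/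
theorem abs_le_of_characteristic_system (hs : u₀ < v₀) (hK : 0 ≤ K)
    (hXc : Continuous fun p : ℝ × ℝ => X p.1 p.2) (hYc : Continuous fun p : ℝ × ℝ => Y p.1 p.2)
    (hkc : Continuous fun p : ℝ × ℝ => k p.1 p.2)
    (hk0 : ∀ u ≤ u₀, ∀ v, v₀ ≤ v → 0 ≤ k u v)
    (hkK : ∀ u ≤ u₀, ∀ v, v₀ ≤ v → k u v ≤ K / (v - u) ^ 2)
    (hX : ∀ u ∈ Icc U u₀, ∀ v, v₀ ≤ v → X u v - X U v = -∫ w in U..u, k w v * Y w v)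
    (hY : ∀ u ∈ Icc U u₀, ∀ v, v₀ ≤ v → Y u v - Y u v₀ = ∫ z in v₀..v, k u z * X u z)
    {u v : ℝ} (hu : u ∈ Icc U u₀) (hv : v₀ ≤ v) :
    |X u v| ≤ |X U v| + K / (v - u₀) ^ 2 * (Real.exp (K ^ 2 / 2 * ((v₀ - u₀) ^ 2)⁻¹) *
      ((∫ w in U..u₀, |Y w v₀|) + ∫ z in v₀..v, K / (z - u₀) * |X U z|)) := by
  have hU : U ≤ u₀ := hu.1.trans hu.2
  have hd : ∀ z, 0 < max z v₀ - u₀ := fun z => sub_pos.2 (hs.trans_le (le_max_right _ _))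
  set A : ℝ → ℝ := fun z => ∫ w in U..u₀, |Y w z| with hA
  have hAc : Continuous A := continuous_parametric_intervalIntegral_of_continuous'
    (f := fun z w => |Y w z|) (hYc.comp continuous_swap).abs U u₀
  have hξc : Continuous fun z => |X U z| := (hXc.comp (Continuous.prodMk_right U)).abs
  set h : ℝ → ℝ := fun z => |X U z| + K / (max z v₀ - u₀) ^ 2 * A z with hh
  have hhc : Continuous h := hξc.add ((continuous_const.div (by fun_prop)
    (fun z => pow_ne_zero 2 (hd z).ne')).mul hAc)
  have hXh : ∀ u ∈ Icc U u₀, ∀ v, v₀ ≤ v → |X u v| ≤ h v := by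
    intro u hu v hv
    simp only [hh, max_eq_left hv]
    exact abs_le_of_transport hs hK hYc hkc hk0 hkK hX hu hv
  have hκ : Continuous fun z => K / (max z v₀ - u₀) :=
    continuous_const.div (by fun_prop) (fun z => (hd z).ne')
  set P : ℝ → ℝ := fun z => A v₀ + ∫ t in v₀..z, K / (max t v₀ - u₀) * h t with hP
  have hAP : ∀ z, v₀ ≤ z → A z ≤ P z := fun z hz =>
    integral_abs_le_of_transport hs hK hU hXc hYc hkc hk0 hkK hY hhc hXh hz
  have hA0 : ∀ z, 0 ≤ A z := fun z => integral_nonneg hU fun w _ => abs_nonneg _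
  set E : ℝ → ℝ := fun z => Real.exp (K ^ 2 / 2 * ((z - u₀) ^ 2)⁻¹) with hE
  set N : ℝ → ℝ := fun z => ∫ t in v₀..z, K / (max t v₀ - u₀) * |X U t| with hN
  have hPd : ∀ z, HasDerivAt P (K / (max z v₀ - u₀) * h z) z := fun z =>
    (((hκ.mul hhc).integral_hasStrictDerivAt v₀ z).hasDerivAt).const_add _
  have hNd : ∀ z, HasDerivAt N (K / (max z v₀ - u₀) * |X U z|) z := fun z =>
    ((hκ.mul hξc).integral_hasStrictDerivAt v₀ z).hasDerivAt
  have hEd : ∀ z, v₀ ≤ z → HasDerivAt E (-(E z * (K ^ 2 / (z - u₀) ^ 3))) z := by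
    intro z hz
    have hz0 : z - u₀ ≠ 0 := by linarith
    have h1 := ((((hasDerivAt_id z).sub_const u₀).fun_pow 2).fun_inv
      (pow_ne_zero 2 hz0)).const_mul (K ^ 2 / 2)
    convert! h1.exp using 1
    simp only [hE, id]
    field_simp
    simp
  have hEanti : ∀ z, v₀ ≤ z → E z ≤ E v₀ := by
    intro z hz
    have : 0 < v₀ - u₀ := by linarith
    refine Real.exp_le_exp.2 ?_
    gcongr
  have hanti : AntitoneOn (fun z => E z * P z - E v₀ * N z) (Icc v₀ v) := by
    have hder : ∀ z, v₀ ≤ z → HasDerivAt (fun z => E z * P z - E v₀ * N z)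
        (-(E z * (K ^ 2 / (z - u₀) ^ 3)) * P z + E z * (K / (max z v₀ - u₀) * h z)
          - E v₀ * (K / (max z v₀ - u₀) * |X U z|)) z := fun z hz =>
      ((hEd z hz).mul (hPd z)).sub ((hNd z).const_mul _)
    refine antitoneOn_of_deriv_nonpos (convex_Icc v₀ v)
      (fun z hz => (hder z hz.1).continuousAt.continuousWithinAt) ?_ ?_
    · rw [interior_Icc]
      exact fun z hz => (hder z hz.1.le).differentiableAt.differentiableWithinAt
    · rw [interior_Icc]
      intro z hz
      rw [(hder z hz.1.le).deriv]
      simp only [hh, max_eq_left hz.1.le]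
      have hz0 : 0 < z - u₀ := by linarith [hz.1]
      have h1 : 0 ≤ (E v₀ - E z) * (K / (z - u₀) * |X U z|) :=
        mul_nonneg (sub_nonneg.2 (hEanti z hz.1.le)) (by positivity)
      have h2 : 0 ≤ E z * (K ^ 2 / (z - u₀) ^ 3) * (P z - A z) :=
        mul_nonneg (mul_nonneg (Real.exp_pos _).le (by positivity))
          (sub_nonneg.2 (hAP z hz.1.le))
      have h3 : K / (z - u₀) * (K / (z - u₀) ^ 2 * A z) = K ^ 2 / (z - u₀) ^ 3 * A z := by
        field_simp
      rw [mul_add (K / (z - u₀)), h3]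
      linarith
  have hmain := hanti ⟨le_rfl, hv⟩ ⟨hv, le_rfl⟩ hv
  have hN0 : N v₀ = 0 := integral_same
  have hP0 : P v₀ = A v₀ := by simp [hP]
  simp only [hN0, hP0, mul_zero, sub_zero] at hmain
  have hE1 : 1 ≤ E v := Real.one_le_exp (by positivity)
  have hAv : A v ≤ E v₀ * (A v₀ + N v) := by
    have h1 := hAP v hv
    have h2 := hA0 v
    nlinarith
  have hNv : N v = ∫ z in v₀..v, K / (z - u₀) * |X U z| := by
    refine integral_congr fun z hz => ?_
    rw [uIcc_of_le hv] at hz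
    simp only [max_eq_left hz.1]
  refine (abs_le_of_transport hs hK hYc hkc hk0 hkK hX hu hv).trans ?_
  rw [← hNv]
  gcongr

end Characteristic

namespace WaveSetup

variable {M u₀ v₀ : ℝ}

theorem lt_sub (W : WaveSetup M u₀ v₀) {u v : ℝ} (hu : u ≤ u₀) (hv : v₀ ≤ v) :
    M + 2 * M * Real.log M < v - u :=
  W.hdom.trans_le (by linarith)

theorem r_mem (W : WaveSetup M u₀ v₀) {u v : ℝ} (hu : u ≤ u₀) (hv : v₀ ≤ v) :
    W.r u v ∈ Ioo 0 M :=
  W.hr_mem u v (W.lt_sub hu hv)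

theorem r_eq (W : WaveSetup M u₀ v₀) {u v : ℝ} (h : M + 2 * M * Real.log M < v - u) :
    W.r u v = W.r 0 (v - u) := by
  have h' : M + 2 * M * Real.log M < v - u - 0 := by rwa [sub_zero]
  refine rstar_strictMonoOn.injOn (W.hr_mem u v h) (W.hr_mem 0 (v - u) h') ?_
  rw [W.hr_star u v h, W.hr_star 0 _ h', sub_zero]

theorem hasDerivAt_r_zero (W : WaveSetup M u₀ v₀) {s : ℝ} (hs : M + 2 * M * Real.log M < s) :
    HasDerivAt (W.r 0) ((1 - M / W.r 0 s) ^ 2) s :=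
  hasDerivAt_of_rstar_eq (fun s hs => W.hr_mem 0 s (by rwa [sub_zero]))
    (fun s hs => by rw [W.hr_star 0 s (by rwa [sub_zero]), sub_zero]) hs

theorem hasDerivAt_r_right (W : WaveSetup M u₀ v₀) {u v : ℝ} (hu : u ≤ u₀) (hv : v₀ ≤ v) :
    HasDerivAt (fun z => W.r u z) (W.Ω2 u v) v := by
  have hs := W.lt_sub hu hv
  have h := (W.hasDerivAt_r_zero hs).comp_sub_const v u
  rw [← W.r_eq hs] at h
  refine h.congr_of_eventuallyEq ?_
  filter_upwards [(continuous_id.sub continuous_const).continuousAt.eventually_const_lt hs]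
    with z hz using W.r_eq hz

theorem hasDerivAt_r_left (W : WaveSetup M u₀ v₀) {u v : ℝ} (hu : u ≤ u₀) (hv : v₀ ≤ v) :
    HasDerivAt (fun w => W.r w v) (-W.Ω2 u v) u := by
  have hs := W.lt_sub hu hv
  have h := (W.hasDerivAt_r_zero hs).comp_const_sub v u
  rw [← W.r_eq hs] at h
  refine h.congr_of_eventuallyEq ?_
  filter_upwards [(continuous_const.sub continuous_id).continuousAt.eventually_const_lt hs]
    with w hw using W.r_eq hw

/-- The restriction of `f` to the region `u ≤ u₀`, `v₀ ≤ v`, extended by nearest point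
projection. -/
def clamp (u₀ v₀ : ℝ) (f : ℝ → ℝ → ℝ) (u v : ℝ) : ℝ := f (min u u₀) (max v v₀)

theorem clamp_of_le {f : ℝ → ℝ → ℝ} {u v : ℝ} (hu : u ≤ u₀) (hv : v₀ ≤ v) :
    clamp u₀ v₀ f u v = f u v := by
  rw [clamp, min_eq_left hu, max_eq_left hv]

theorem continuous_clamp {f : ℝ → ℝ → ℝ}
    (hf : ContinuousOn (fun p : ℝ × ℝ => f p.1 p.2) (Iic u₀ ×ˢ Ici v₀)) :
    Continuous fun p : ℝ × ℝ => clamp u₀ v₀ f p.1 p.2 :=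
  hf.comp_continuous (f := fun p : ℝ × ℝ => (min p.1 u₀, max p.2 v₀)) (by fun_prop)
    fun _ => ⟨mem_Iic.2 (min_le_right _ _), mem_Ici.2 (le_max_right _ _)⟩

theorem continuousOn_r (W : WaveSetup M u₀ v₀) :
    ContinuousOn (fun p : ℝ × ℝ => W.r p.1 p.2) (Iic u₀ ×ˢ Ici v₀) := by
  have h : ContinuousOn (fun p : ℝ × ℝ => W.r 0 (p.2 - p.1)) (Iic u₀ ×ˢ Ici v₀) := fun p hp =>
    ((W.hasDerivAt_r_zero (W.lt_sub hp.1 hp.2)).continuousAt.comp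
      (f := fun p : ℝ × ℝ => p.2 - p.1) (by fun_prop)).continuousWithinAt
  exact h.congr fun p hp => W.r_eq (W.lt_sub hp.1 hp.2)

theorem continuousOn_Ω2 (W : WaveSetup M u₀ v₀) :
    ContinuousOn (fun p : ℝ × ℝ => W.Ω2 p.1 p.2) (Iic u₀ ×ˢ Ici v₀) :=
  (continuousOn_const.sub (continuousOn_const.div W.continuousOn_r
    fun _ hp => (W.r_mem hp.1 hp.2).1.ne')).pow 2

theorem continuous_clamp_r_mul_φu (W : WaveSetup M u₀ v₀) :
    Continuous fun p : ℝ × ℝ => clamp u₀ v₀ (fun w z => W.r w z * W.φu w z) p.1 p.2 :=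
  continuous_clamp (f := fun w z => W.r w z * W.φu w z) (W.continuousOn_r.mul W.hφu_cont)

theorem continuous_clamp_r_mul_φv (W : WaveSetup M u₀ v₀) :
    Continuous fun p : ℝ × ℝ => clamp u₀ v₀ (fun w z => W.r w z * W.φv w z) p.1 p.2 :=
  continuous_clamp (f := fun w z => W.r w z * W.φv w z) (W.continuousOn_r.mul W.hφv_cont)

/-- The coefficient `Ω² / r` coupling `r ∂_u φ` and `r ∂_v φ`. -/
noncomputable def coupling (W : WaveSetup M u₀ v₀) (u v : ℝ) : ℝ := W.Ω2 u v / W.r u v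

theorem continuousOn_coupling (W : WaveSetup M u₀ v₀) :
    ContinuousOn (fun p : ℝ × ℝ => W.coupling p.1 p.2) (Iic u₀ ×ˢ Ici v₀) :=
  W.continuousOn_Ω2.div W.continuousOn_r fun _ hp => (W.r_mem hp.1 hp.2).1.ne'

theorem φuv_eq (W : WaveSetup M u₀ v₀) {u v : ℝ} (hu : u ≤ u₀) (hv : v₀ ≤ v) :
    W.φuv u v = W.coupling u v * (W.φv u v - W.φu u v) := by
  have h := W.hwave u hu v hv
  have hr := (W.r_mem hu hv).1.ne'
  rw [coupling, Ω2, div_mul_eq_mul_div, eq_div_iff hr]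
  linarith

theorem continuousOn_φuv (W : WaveSetup M u₀ v₀) :
    ContinuousOn (fun p : ℝ × ℝ => W.φuv p.1 p.2) (Iic u₀ ×ˢ Ici v₀) :=
  (W.continuousOn_coupling.mul (W.hφv_cont.sub W.hφu_cont)).congr
    fun _ hp => W.φuv_eq hp.1 hp.2

theorem φv_sub_eq_integral (W : WaveSetup M u₀ v₀) {U u v : ℝ} (hU : U ≤ u) (hu : u ≤ u₀)
    (hv : v₀ ≤ v) : W.φv u v - W.φv U v = ∫ w in U..u, clamp u₀ v₀ W.φuv w v := by
  refine sub_eq_integral_of_mixed (f := W.φ) (continuous_clamp W.hφu_cont)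
    (continuous_clamp W.continuousOn_φuv) ?_ W.hφv ?_ hU hu hv
  · intro u hu v hv
    rw [clamp_of_le hu hv]
    exact W.hφu u hu v hv
  · intro u hu v hv
    rw [clamp_of_le hu hv]
    exact (W.hφuv u hu v hv).congr (fun z hz => clamp_of_le hu hz) (clamp_of_le hu hv)

theorem hasDerivAt_φv_left (W : WaveSetup M u₀ v₀) {u v : ℝ} (hu : u < u₀) (hv : v₀ ≤ v) :
    HasDerivAt (fun w => W.φv w v) (W.φuv u v) u := by
  have hc : Continuous fun w => clamp u₀ v₀ W.φuv w v :=
    (continuous_clamp W.continuousOn_φuv).comp (Continuous.prodMk_left v)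
  have h := ((hc.integral_hasStrictDerivAt (u - 1) u).hasDerivAt).const_add (W.φv (u - 1) v)
  rw [clamp_of_le hu.le hv] at h
  refine h.congr_of_eventuallyEq ?_
  filter_upwards [Ioo_mem_nhds (sub_one_lt u) hu] with w hw
  rw [← W.φv_sub_eq_integral hw.1.le hw.2.le hv]
  ring

theorem r_mul_φv_sub_eq (W : WaveSetup M u₀ v₀) {U u v : ℝ} (hU : U ≤ u) (hu : u ≤ u₀)
    (hv : v₀ ≤ v) :
    W.r u v * W.φv u v - W.r U v * W.φv U v =
      -∫ w in U..u, clamp u₀ v₀ W.coupling w v *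
        clamp u₀ v₀ (fun w z => W.r w z * W.φu w z) w v := by
  rw [← intervalIntegral.integral_neg]
  symm
  have hmaps : MapsTo (fun w => (w, v)) (Icc U u) (Iic u₀ ×ˢ Ici v₀) :=
    fun w hw => ⟨hw.2.trans hu, hv⟩
  refine integral_eq_sub_of_hasDeriv_right_of_le (f := fun w => W.r w v * W.φv w v) hU ?_ ?_ ?_
  · exact (W.continuousOn_r.mul W.hφv_cont).comp (Continuous.prodMk_left v).continuousOn hmaps
  · intro w hw
    have hwu : w < u₀ := hw.2.trans_le hu
    have h := (W.hasDerivAt_r_left hwu.le hv).mul (W.hasDerivAt_φv_left hwu hv)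
    convert! h.hasDerivWithinAt using 1
    rw [clamp_of_le hwu.le hv, clamp_of_le hwu.le hv, W.φuv_eq hwu.le hv, coupling]
    have hr := (W.r_mem hwu.le hv).1.ne'
    field_simp
    ring
  · exact (((continuous_clamp W.continuousOn_coupling).mul W.continuous_clamp_r_mul_φu).comp
      (Continuous.prodMk_left v)).neg.intervalIntegrable _ _

theorem r_mul_φu_sub_eq (W : WaveSetup M u₀ v₀) {u v : ℝ} (hu : u ≤ u₀) (hv : v₀ ≤ v) :
    W.r u v * W.φu u v - W.r u v₀ * W.φu u v₀ =
      ∫ z in v₀..v, clamp u₀ v₀ W.coupling u z *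
        clamp u₀ v₀ (fun w z => W.r w z * W.φv w z) u z := by
  symm
  have hmaps : MapsTo (fun z => (u, z)) (Icc v₀ v) (Iic u₀ ×ˢ Ici v₀) :=
    fun z hz => ⟨hu, hz.1⟩
  refine integral_eq_sub_of_hasDeriv_right_of_le (f := fun z => W.r u z * W.φu u z) hv ?_ ?_ ?_
  · exact (W.continuousOn_r.mul W.hφu_cont).comp (Continuous.prodMk_right u).continuousOn hmaps
  · intro z hz
    have h := (W.hasDerivAt_r_right hu hz.1.le).mul
      ((W.hφuv u hu z hz.1.le).hasDerivAt (Ici_mem_nhds hz.1))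
    convert! h.hasDerivWithinAt using 1
    rw [clamp_of_le hu hz.1.le, clamp_of_le hu hz.1.le, W.φuv_eq hu hz.1.le, coupling]
    have hr := (W.r_mem hu hz.1.le).1.ne'
    field_simp
    ring
  · exact (((continuous_clamp W.continuousOn_coupling).mul W.continuous_clamp_r_mul_φv).comp
      (Continuous.prodMk_right u)).intervalIntegrable _ _

theorem coupling_nonneg (W : WaveSetup M u₀ v₀) {u v : ℝ} (hu : u ≤ u₀) (hv : v₀ ≤ v) :
    0 ≤ W.coupling u v :=
  div_nonneg (sq_nonneg _) (W.r_mem hu hv).1.le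

theorem Ω2_eq (W : WaveSetup M u₀ v₀) {u v : ℝ} (hu : u ≤ u₀) (hv : v₀ ≤ v) :
    W.Ω2 u v = (M - W.r u v) ^ 2 / W.r u v ^ 2 := by
  have hr := (W.r_mem hu hv).1.ne'
  rw [Ω2]
  field_simp
  ring

theorem coupling_le (W : WaveSetup M u₀ v₀) {δ u v : ℝ} (hδ : 0 < δ) (hδr : δ ≤ W.r u v)
    (hu : u ≤ u₀) (hv : v₀ ≤ v) :
    W.coupling u v ≤ (2 * M ^ 2 + 2 * M ^ 3) ^ 2 / δ ^ 3 / (v - u) ^ 2 := by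
  have hm := W.r_mem hu hv
  have hr := hm.1
  have hx : 0 ≤ M - W.r u v := sub_nonneg.2 hm.2.le
  have hs : 0 < v - u := by linarith [W.hu₀, W.hv₀]
  have h1 := rstar_mul_sub_le hm
  rw [W.hr_star u v (W.lt_sub hu hv)] at h1
  have h2 : W.coupling u v = ((v - u) * (M - W.r u v)) ^ 2 / W.r u v ^ 3 / (v - u) ^ 2 := by
    rw [coupling, W.Ω2_eq hu hv]
    field_simp
  rw [h2]
  gcongr

theorem r_mul_abs_φv_le (W : WaveSetup M u₀ v₀) {δ U u v : ℝ} (hδ : 0 < δ)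
    (hδr : ∀ u ≤ u₀, ∀ v, v₀ ≤ v → δ ≤ W.r u v) {K : ℝ}
    (hK : K = (2 * M ^ 2 + 2 * M ^ 3) ^ 2 / δ ^ 3)
    (hφ : IntegrableOn (fun w => |W.φu w v₀|) (Iic u₀))
    (hU : U ≤ u) (hu : u ≤ u₀) (hv : v₀ ≤ v) :
    W.r u v * |W.φv u v| ≤ M * (|W.φv U v| + K / (v - u₀) ^ 2 *
      (Real.exp (K ^ 2 / 2 * ((v₀ - u₀) ^ 2)⁻¹) *
        ((∫ w in Iic u₀, |W.φu w v₀|) + ∫ z in v₀..v, K / (z - u₀) * |W.φv U z|))) := by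
  have hM := W.hM
  have hs : u₀ < v₀ := W.hu₀.trans W.hv₀
  have hK0 : 0 ≤ K := by rw [hK]; positivity
  have hU₀ : U ≤ u₀ := hU.trans hu
  have key := abs_le_of_characteristic_system (U := U) (K := K)
    (X := clamp u₀ v₀ fun w z => W.r w z * W.φv w z)
    (Y := clamp u₀ v₀ fun w z => W.r w z * W.φu w z) (k := clamp u₀ v₀ W.coupling) hs hK0
    W.continuous_clamp_r_mul_φv
    W.continuous_clamp_r_mul_φu
    (continuous_clamp W.continuousOn_coupling)
    (fun u hu v hv => by rw [clamp_of_le hu hv]; exact W.coupling_nonneg hu hv)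
    (fun u hu v hv => by
      rw [clamp_of_le hu hv, hK]; exact W.coupling_le hδ (hδr u hu v hv) hu hv)
    (fun u hu v hv => by
      rw [clamp_of_le hu.2 hv, clamp_of_le hU₀ hv, W.r_mul_φv_sub_eq hu.1 hu.2 hv])
    (fun u hu v hv => by
      rw [clamp_of_le hu.2 hv, clamp_of_le hu.2 le_rfl, W.r_mul_φu_sub_eq hu.2 hv])
    ⟨hU, hu⟩ hv
  rw [clamp_of_le hu hv, clamp_of_le hU₀ hv, abs_mul, abs_mul,
    abs_of_pos (W.r_mem hu hv).1, abs_of_pos (W.r_mem hU₀ hv).1] at key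
  refine key.trans ?_
  have h1 : ∫ w in U..u₀, |clamp u₀ v₀ (fun w z => W.r w z * W.φu w z) w v₀| ≤
      M * ∫ w in Iic u₀, |W.φu w v₀| := by
    have hle : ∫ w in U..u₀, |W.φu w v₀| ≤ ∫ w in Iic u₀, |W.φu w v₀| := by
      rw [integral_of_le hU₀]
      exact setIntegral_mono_set hφ (ae_of_all _ fun w => abs_nonneg _)
        (Ioc_subset_Iic_self.eventuallyLE)
    refine le_trans ?_ (mul_le_mul_of_nonneg_left hle hM.le)
    rw [← intervalIntegral.integral_const_mul]
    refine integral_mono_on hU₀ ?_ ?_ ?_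
    · exact (W.continuous_clamp_r_mul_φu.comp
        (Continuous.prodMk_left v₀)).abs.intervalIntegrable _ _
    · refine IntervalIntegrable.const_mul ?_ _
      rw [intervalIntegrable_iff_integrableOn_Ioc_of_le hU₀]
      exact hφ.mono_set Ioc_subset_Iic_self
    · intro w hw
      rw [clamp_of_le hw.2 le_rfl, abs_mul, abs_of_pos (W.r_mem hw.2 le_rfl).1]
      exact mul_le_mul_of_nonneg_right (W.r_mem hw.2 le_rfl).2.le (abs_nonneg _)
  have h2 : ∫ z in v₀..v, K / (z - u₀) * |clamp u₀ v₀ (fun w z => W.r w z * W.φv w z) U z| ≤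
      M * ∫ z in v₀..v, K / (z - u₀) * |W.φv U z| := by
    have hne : ∀ z ∈ uIcc v₀ v, z - u₀ ≠ 0 := by
      intro z hz
      rw [uIcc_of_le hv] at hz
      exact (sub_pos.2 (hs.trans_le hz.1)).ne'
    have hκ : ContinuousOn (fun z => K / (z - u₀)) (uIcc v₀ v) :=
      continuousOn_const.div (by fun_prop) hne
    have hmaps : MapsTo (fun z => (U, z)) (uIcc v₀ v) (Iic u₀ ×ˢ Ici v₀) := by
      rw [uIcc_of_le hv]
      exact fun z hz => ⟨hU₀, hz.1⟩
    rw [← intervalIntegral.integral_const_mul]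
    refine integral_mono_on hv ?_ ?_ ?_
    · exact (hκ.mul (W.continuous_clamp_r_mul_φv.comp
        (Continuous.prodMk_right U)).abs.continuousOn).intervalIntegrable
    · exact (continuousOn_const.mul (hκ.mul (W.hφv_cont.comp
        (Continuous.prodMk_right U).continuousOn hmaps).abs)).intervalIntegrable
    · intro z hz
      have hz0 : 0 < z - u₀ := by linarith [hz.1]
      rw [clamp_of_le hU₀ hz.1, abs_mul, abs_of_pos (W.r_mem hU₀ hz.1).1, mul_left_comm]
      exact mul_le_mul_of_nonneg_right (W.r_mem hU₀ hz.1).2.le (by positivity)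
  have h3 := mul_le_mul_of_nonneg_right (W.r_mem hU₀ hv).2.le (abs_nonneg (W.φv U v))
  rw [mul_add M]
  refine add_le_add h3 ?_
  rw [mul_left_comm M, mul_left_comm M, mul_add M]
  gcongr

theorem inv_Ω2_le (W : WaveSetup M u₀ v₀) {L v : ℝ} (hL0 : 0 ≤ L)
    (hL : ∀ ρ ∈ Ioo 0 M, M ^ 2 / (2 * (M - ρ)) ≤ rstar M ρ + L) (hv : v₀ ≤ v) :
    (W.Ω2 u₀ v)⁻¹ ≤ (2 * (1 + (L - u₀) / v₀) / M) ^ 2 * v ^ 2 := by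
  have hM := W.hM
  have hu₀ := W.hu₀
  have hv₀ := W.hv₀
  have hm := W.r_mem le_rfl hv
  have hx : 0 < M - W.r u₀ v := sub_pos.2 hm.2
  have h1 := hL _ hm
  rw [W.hr_star _ _ (W.lt_sub le_rfl hv)] at h1
  have h2 : v - u₀ + L ≤ (1 + (L - u₀) / v₀) * v := by
    have h3 : L - u₀ ≤ (L - u₀) / v₀ * v := by
      rw [div_mul_eq_mul_div, le_div_iff₀ hv₀]
      exact mul_le_mul_of_nonneg_left hv (by linarith)
    linarith
  rw [W.Ω2_eq le_rfl hv, inv_div, ← div_pow, ← mul_pow]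
  refine pow_le_pow_left₀ (div_nonneg hm.1.le hx.le) ?_ 2
  calc W.r u₀ v / (M - W.r u₀ v) ≤ M / (M - W.r u₀ v) := by gcongr; exact hm.2.le
    _ = 2 / M * (M ^ 2 / (2 * (M - W.r u₀ v))) := by field_simp
    _ ≤ 2 / M * ((1 + (L - u₀) / v₀) * v) := by gcongr; exact h1.trans h2
    _ = _ := by ring

end WaveSetup

namespace WaveSetupH

variable {M u₀ v₀ : ℝ}

theorem r_mul_abs_φv_le (W : WaveSetupH M u₀ v₀) {δ u v : ℝ} (hδ : 0 < δ)
    (hδr : ∀ u ≤ u₀, ∀ v, v₀ ≤ v → δ ≤ W.r u v) {K : ℝ}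
    (hK : K = (2 * M ^ 2 + 2 * M ^ 3) ^ 2 / δ ^ 3)
    (hφ : IntegrableOn (fun w => |W.φu w v₀|) (Iic u₀)) (hu : u ≤ u₀) (hv : v₀ ≤ v) :
    W.r u v * |W.φv u v| ≤ M * (|W.φH' v| + K / (v - u₀) ^ 2 *
      (Real.exp (K ^ 2 / 2 * ((v₀ - u₀) ^ 2)⁻¹) *
        ((∫ w in Iic u₀, |W.φu w v₀|) + ∫ z in v₀..v, K / (z - u₀) * |W.φH' z|))) := by
  have hs : u₀ < v₀ := W.hu₀.trans W.hv₀
  have hK0 : 0 ≤ K := by rw [hK]; have := W.hM; positivity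
  have hφvc : ∀ U ≤ u₀, ContinuousOn (fun z => W.φv U z) (Ici v₀) := fun U hU =>
    W.hφv_cont.comp (Continuous.prodMk_right U).continuousOn fun z hz => ⟨hU, hz⟩
  have hHc : ContinuousOn W.φH' (Ici v₀) :=
    W.hφH'_tendsto.continuousOn ((eventually_le_atBot u₀).mono hφvc).frequently
  have hsub : uIcc v₀ v ⊆ Ici v₀ := by
    rw [uIcc_of_le hv]; exact Icc_subset_Ici_self
  have hκ : ContinuousOn (fun z => K / (z - u₀)) (Ici v₀) :=
    continuousOn_const.div (by fun_prop) fun z hz => (sub_pos.2 (hs.trans_le hz)).ne'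
  have hunif : TendstoUniformlyOn (fun u v => W.φv u v) W.φH' atBot (uIcc v₀ v) :=
    (tendstoLocallyUniformlyOn_iff_tendstoUniformlyOn_of_compact isCompact_uIcc).1
      (W.hφH'_tendsto.mono hsub)
  have hlim : Tendsto (fun U => ∫ z in v₀..v, K / (z - u₀) * |W.φv U z|) atBot
      (𝓝 (∫ z in v₀..v, K / (z - u₀) * |W.φH' z|)) := by
    refine intervalIntegral.tendsto_integral_filter_of_dominated_convergence
      (fun z => K / (z - u₀) * (|W.φH' z| + 1)) ?_ ?_ ?_ ?_
    · filter_upwards [eventually_le_atBot u₀] with U hU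
      exact ((hκ.mul (hφvc U hU).abs).mono
        (uIoc_subset_uIcc.trans hsub)).aestronglyMeasurable measurableSet_uIoc
    · filter_upwards [Metric.tendstoUniformlyOn_iff.1 hunif 1 one_pos] with U hU
      refine ae_of_all _ fun z hz => ?_
      have hz' := uIoc_subset_uIcc hz
      have hz0 : 0 < z - u₀ := sub_pos.2 (hs.trans_le (hsub hz'))
      have h := hU z hz'
      rw [dist_comm, Real.dist_eq] at h
      have h1 := abs_sub_abs_le_abs_sub (W.φv U z) (W.φH' z)
      rw [Real.norm_eq_abs, abs_mul, abs_abs, abs_of_nonneg (by positivity)]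
      exact mul_le_mul_of_nonneg_left (by linarith) (by positivity)
    · exact ((hκ.mul (hHc.abs.add continuousOn_const)).mono hsub).intervalIntegrable
    · refine ae_of_all _ fun z hz => ?_
      exact ((hunif.tendsto_at (uIoc_subset_uIcc hz)).abs).const_mul _
  have hlimv : Tendsto (fun U => |W.φv U v|) atBot (𝓝 |W.φH' v|) :=
    (hunif.tendsto_at right_mem_uIcc).abs
  refine ge_of_tendsto ((hlimv.add (((hlim.const_add _).const_mul _).const_mul _)).const_mul M) ?_
  filter_upwards [eventually_le_atBot u] with U hU
  exact W.toWaveSetup.r_mul_abs_φv_le hδ hδr hK hφ hU hu hv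

theorem integral_div_mul_le (W : WaveSetupH M u₀ v₀) {K q v : ℝ} (hK : 0 ≤ K) (hq : q < 1)
    (hφ : IntegrableOn (fun z => z ^ (-q) * |W.φH' z|) (Ioi v₀)) (hv : v₀ ≤ v) :
    ∫ z in v₀..v, K / (z - u₀) * |W.φH' z| ≤
      K * v₀ ^ (q - 1) * ∫ z in Ioi v₀, z ^ (-q) * |W.φH' z| := by
  have hu₀ := W.hu₀
  have hv₀ := W.hv₀
  have hnn : ∀ z ∈ Ioi v₀, 0 ≤ z ^ (-q) * |W.φH' z| := fun z hz =>
    mul_nonneg (Real.rpow_nonneg (hv₀.trans hz).le _) (abs_nonneg _)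
  have hle : ∫ z in Ioc v₀ v, z ^ (-q) * |W.φH' z| ≤ ∫ z in Ioi v₀, z ^ (-q) * |W.φH' z| :=
    setIntegral_mono_set hφ ((ae_restrict_iff' measurableSet_Ioi).2 (ae_of_all _ hnn))
      Ioc_subset_Ioi_self.eventuallyLE
  refine le_trans ?_ (mul_le_mul_of_nonneg_left hle
    (mul_nonneg hK (Real.rpow_nonneg hv₀.le _)))
  rw [integral_of_le hv, ← MeasureTheory.integral_const_mul]
  refine integral_mono_of_nonneg ?_ ((hφ.mono_set Ioc_subset_Ioi_self).const_mul _) ?_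
  · refine (ae_restrict_iff' measurableSet_Ioc).2 (ae_of_all _ fun z hz => ?_)
    have : 0 < z - u₀ := by linarith [hz.1]
    exact mul_nonneg (by positivity) (abs_nonneg _)
  · refine (ae_restrict_iff' measurableSet_Ioc).2 (ae_of_all _ fun z hz => ?_)
    have hz0 : 0 < z := hv₀.trans hz.1
    have h1 : z⁻¹ ≤ v₀ ^ (q - 1) * z ^ (-q) := by
      calc z⁻¹ = z ^ (q - 1) * z ^ (-q) := by
            rw [← Real.rpow_add hz0, ← Real.rpow_neg_one]; ring_nf
        _ ≤ v₀ ^ (q - 1) * z ^ (-q) := by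
            refine mul_le_mul_of_nonneg_right ?_ (Real.rpow_nonneg hz0.le _)
            exact Real.rpow_le_rpow_of_nonpos hv₀ hz.1.le (by linarith)
    calc K / (z - u₀) * |W.φH' z| ≤ K * z⁻¹ * |W.φH' z| := by
          rw [← div_eq_mul_inv]
          gcongr
          linarith
      _ ≤ K * (v₀ ^ (q - 1) * z ^ (-q)) * |W.φH' z| := by gcongr
      _ = _ := by ring

end WaveSetupH

/-- **Uniform boundedness of `∂_V φ₀`** (Proposition 4.4): with
`F_q[φ] = ∫_{-∞}^{u₀} |∂_u φ|(u',v₀) du' + ∫_{v₀}^{∞} v'^{-q} |φ_H'(v')| dv' < ∞`,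
there is a constant `C = C(M,u₀,v₀,q) > 0`, independent of `φ`, such that the
regular outgoing derivative `∂_V φ = Ω^{-2}(u₀,v) ∂_v φ` satisfies
`|∂_V φ(u,v)| ≤ C (v² |φ_H'(v)| + F_q[φ])` on `D`. -/
theorem pointwise_bound_dVφ (M u₀ v₀ q : ℝ) (hq₁ : -1 < q) (hq₂ : q < 1) :
    ∃ C > (0:ℝ), ∀ W : WaveSetupH M u₀ v₀,
      IntegrableOn (fun u' => |W.φu u' v₀|) (Set.Iic u₀) →
      IntegrableOn (fun v' => v' ^ (-q) * |W.φH' v'|) (Set.Ioi v₀) →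
      ∀ u ≤ u₀, ∀ v : ℝ, v₀ ≤ v →
        |W.toWaveSetup.dVφ u v| ≤
          C * (v ^ 2 * |W.φH' v| +
            ((∫ u' in Set.Iic u₀, |W.φu u' v₀|) +
              ∫ v' in Set.Ioi v₀, v' ^ (-q) * |W.φH' v'|)) := by
  by_cases hdom : 0 < M ∧ u₀ < 0 ∧ 0 < v₀ ∧ M + 2 * M * Real.log M < v₀ - u₀
  swap
  · exact ⟨1, one_pos, fun W => (hdom ⟨W.hM, W.hu₀, W.hv₀, W.hdom⟩).elim⟩
  obtain ⟨hM, hu₀, hv₀, hs₀⟩ := hdom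
  obtain ⟨δ, hδ, hδr⟩ := exists_le_of_lt_rstar hM hs₀
  obtain ⟨L, hL0, hL⟩ := exists_inv_sub_le_rstar hM
  obtain ⟨K, hK⟩ : ∃ K, K = (2 * M ^ 2 + 2 * M ^ 3) ^ 2 / δ ^ 3 := ⟨_, rfl⟩
  have hK0 : 0 ≤ K := by rw [hK]; positivity
  set E := Real.exp (K ^ 2 / 2 * ((v₀ - u₀) ^ 2)⁻¹)
  have hE : 0 < E := Real.exp_pos _
  set B := (2 * (1 + (L - u₀) / v₀) / M) ^ 2
  have hB : 0 < B := by
    have : 0 ≤ (L - u₀) / v₀ := div_nonneg (by linarith) hv₀.le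
    positivity
  have hc : 0 < v₀ ^ (q - 1) := Real.rpow_pos_of_pos hv₀ _
  refine ⟨B * (M / δ) * (1 + K * E * (1 + K * v₀ ^ (q - 1))), by positivity, ?_⟩
  intro W hI₁ hI₂ u hu v hv
  have hv0 : 0 < v := hv₀.trans_le hv
  have hδW : ∀ u ≤ u₀, ∀ v, v₀ ≤ v → δ ≤ W.r u v := fun u hu v hv => by
    refine hδr _ (W.r_mem hu hv) ?_
    rw [W.hr_star u v (W.lt_sub hu hv)]
    linarith
  set I₁ := ∫ u' in Set.Iic u₀, |W.φu u' v₀|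
  set I₂ := ∫ v' in Set.Ioi v₀, v' ^ (-q) * |W.φH' v'|
  have hI₁0 : 0 ≤ I₁ := MeasureTheory.integral_nonneg fun _ => abs_nonneg _
  have hI₂0 : 0 ≤ I₂ := setIntegral_nonneg measurableSet_Ioi fun z hz =>
    mul_nonneg (Real.rpow_nonneg (hv₀.trans hz).le _) (abs_nonneg _)
  have h1 := W.r_mul_abs_φv_le hδ hδW hK hI₁ hu hv
  have h2 := W.integral_div_mul_le hK0 hq₂ hI₂ hv
  have hJ : 0 ≤ ∫ z in v₀..v, K / (z - u₀) * |W.φH' z| :=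
    intervalIntegral.integral_nonneg hv fun z hz =>
      mul_nonneg (div_nonneg hK0 (by linarith [hz.1])) (abs_nonneg _)
  have h3 : δ * |W.φv u v| ≤
      M * (|W.φH' v| + K / v ^ 2 * (E * (I₁ + K * v₀ ^ (q - 1) * I₂))) := by
    refine ((mul_le_mul_of_nonneg_right (hδW u hu v hv) (abs_nonneg _)).trans h1).trans ?_
    have h4 : (∫ w in Iic u₀, |W.φu w v₀|) + ∫ z in v₀..v, K / (z - u₀) * |W.φH' z| ≤
        I₁ + K * v₀ ^ (q - 1) * I₂ := add_le_add_right h2 _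
    have h5 : K / (v - u₀) ^ 2 ≤ K / v ^ 2 := by
      gcongr
      linarith
    refine mul_le_mul_of_nonneg_left (add_le_add_right ?_ _) hM.le
    exact mul_le_mul h5 (mul_le_mul_of_nonneg_left h4 hE.le)
      (mul_nonneg hE.le (add_nonneg hI₁0 hJ)) (by positivity)
  have h4 : |W.toWaveSetup.dVφ u v| ≤ B * v ^ 2 * |W.φv u v| := by
    rw [WaveSetup.dVφ, abs_mul,
      abs_of_nonneg (inv_nonneg.2 (show 0 ≤ W.toWaveSetup.Ω2 u₀ v from sq_nonneg _))]
    exact mul_le_mul_of_nonneg_right (W.inv_Ω2_le hL0 hL hv) (abs_nonneg _)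
  calc |W.toWaveSetup.dVφ u v| ≤ B * v ^ 2 * |W.φv u v| := h4
    _ = B * v ^ 2 / δ * (δ * |W.φv u v|) := by field_simp
    _ ≤ B * v ^ 2 / δ *
        (M * (|W.φH' v| + K / v ^ 2 * (E * (I₁ + K * v₀ ^ (q - 1) * I₂)))) := by gcongr
    _ = B * (M / δ) * (v ^ 2 * |W.φH' v| + K * E * (I₁ + K * v₀ ^ (q - 1) * I₂)) := by
        field_simp
    _ ≤ B * (M / δ) * ((1 + K * E * (1 + K * v₀ ^ (q - 1))) *
        (v ^ 2 * |W.φH' v| + (I₁ + I₂))) := by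
        gcongr
        have ha : 0 ≤ K * E := by positivity
        have hb : 0 ≤ K * v₀ ^ (q - 1) := by positivity
        have hF : 0 ≤ v ^ 2 * |W.φH' v| := by positivity
        have h5 : I₁ + K * v₀ ^ (q - 1) * I₂ ≤
            (1 + K * v₀ ^ (q - 1)) * (v ^ 2 * |W.φH' v| + (I₁ + I₂)) := by
          nlinarith [mul_nonneg hb hF, mul_nonneg hb hI₁0]
        nlinarith [mul_le_mul_of_nonneg_left h5 ha]
    _ = _ := by ring
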